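/- arXiv:math/0612658 — 2 statements merged into one kernel-verified Lean document; each statement's English description precedes it below -/
import Mathlib

section
/- Let S ⊆ ℕ, let d ≥ 1, and set S_d = ⋃_{i=1}^d ((S + i) ∩ S). Then for every n ≥ 1 one has the inequality (d + 1) · |S ∩ ℕ_n| ≤ n + d + d · |S_d ∩ ℕ_n|. -/
/-- For `S ⊆ ℕ` and `d ≥ 1`, the set `S_d = ⋃_{i=1}^d ((S + i) ∩ S)`, where
`S + i = {s + i : s ∈ S}`.  In other words, `S_d` consists of those `s ∈ S` such that
some element of `S` lies in the interval `[s − d, s − 1]`. -/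
def sparseSd (S : Set ℕ) (d : ℕ) : Set ℕ :=
  ⋃ i ∈ Finset.Icc 1 d, (((· + i) '' S) ∩ S)

theorem mem_sparseSd {S : Set ℕ} {d m : ℕ} :
    m ∈ sparseSd S d ↔ m ∈ S ∧ ∃ s ∈ S, s < m ∧ m ≤ s + d := by
  simp only [sparseSd, Set.mem_iUnion, Set.mem_inter_iff, Set.mem_image, Finset.mem_Icc,
    exists_prop]
  constructor
  · rintro ⟨i, ⟨hi, hid⟩, ⟨s, hs, rfl⟩, hm⟩
    exact ⟨hm, s, hs, by omega, by omega⟩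
  · rintro ⟨hm, s, hs, hsm, hmd⟩
    exact ⟨m - s, ⟨by omega, by omega⟩, ⟨s, hs, by omega⟩, hm⟩

theorem ncard_inter_Iio_succ_of_mem {A : Set ℕ} {m : ℕ} (h : m ∈ A) :
    (A ∩ Set.Iio (m + 1)).ncard = (A ∩ Set.Iio m).ncard + 1 := by
  rw [← Set.ncard_insert_of_notMem (a := m) (by simp) ((Set.finite_Iio m).inter_of_right A)]
  congr 1
  ext x
  simp only [Set.mem_inter_iff, Set.mem_Iio, Set.mem_insert_iff]
  grind

theorem inter_Iio_succ_of_notMem {A : Set ℕ} {m : ℕ} (h : m ∉ A) :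
    A ∩ Set.Iio (m + 1) = A ∩ Set.Iio m := by
  ext x
  simp only [Set.mem_inter_iff, Set.mem_Iio]
  grind

theorem inter_Iio_eq_inter_Iio_sub {S : Set ℕ} {d m : ℕ} (hm : m ∈ S) (h : m ∉ sparseSd S d) :
    S ∩ Set.Iio m = S ∩ Set.Iio (m - d) := by
  rw [mem_sparseSd] at h
  ext x
  simp only [Set.mem_inter_iff, Set.mem_Iio]
  refine ⟨fun ⟨hx, hxm⟩ => ⟨hx, ?_⟩, fun ⟨hx, hxm⟩ => ⟨hx, by omega⟩⟩
  by_contra hlt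
  exact h ⟨hm, x, hx, hxm, by omega⟩

/-- The estimate (3.2) in the proof of Lemma 3.3: for every `n ≥ 1`,
`(d + 1) * |S ∩ ℕ_n| ≤ n + d + d * |S_d ∩ ℕ_n|`, where `ℕ_n = {0, …, n−1}`. -/
theorem card_inter_le (S : Set ℕ) (d : ℕ) (hd : 1 ≤ d) (n : ℕ) (hn : 1 ≤ n) :
    (d + 1) * (S ∩ Set.Iio n).ncard ≤ n + d + d * ((sparseSd S d ∩ Set.Iio n).ncard) := by
  clear hn
  induction n using Nat.strong_induction_on with
  | _ n ih =>
    obtain _ | m := n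
    · simp
    have ihm := ih m (by omega)
    by_cases hS : m ∈ S
    · by_cases hT : m ∈ sparseSd S d
      · rw [ncard_inter_Iio_succ_of_mem hS, ncard_inter_Iio_succ_of_mem hT]
        linarith
      · rw [ncard_inter_Iio_succ_of_mem hS, inter_Iio_succ_of_notMem hT,
          inter_Iio_eq_inter_Iio_sub hS hT]
        rcases le_total m d with hmd | hmd
        · have hz : (S ∩ Set.Iio (m - d)).ncard = 0 := by simp [Nat.sub_eq_zero_of_le hmd]
          rw [hz, zero_add, mul_one]
          omega
        · have ihk := ih (m - d) (by omega)
          have hle : (sparseSd S d ∩ Set.Iio (m - d)).ncard ≤ (sparseSd S d ∩ Set.Iio m).ncard :=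
            Set.ncard_le_ncard
              (Set.inter_subset_inter_right _ (Set.Iio_subset_Iio (Nat.sub_le m d)))
              ((Set.finite_Iio m).inter_of_right _)
          have hmul := Nat.mul_le_mul_left d hle
          rw [Nat.sub_add_cancel hmd] at ihk
          linarith
    · have hT : m ∉ sparseSd S d := fun h => hS (mem_sparseSd.1 h).1
      rw [inter_Iio_succ_of_notMem hS, inter_Iio_succ_of_notMem hT]
      omega
end

section
/- Let Q be a ℤ-graded ring and S a graded subring of Q contained in nonnegative degrees. Then the maximal right torsion extension T(S) = {x ∈ Q : x·S_{≥n} ⊆ S for some n ≥ 0} is a subring of Q containing S, and T(S) is itself graded: for every x ∈ T(S), each homogeneous component of x again lies in T(S). -/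
variable {Q : Type*} [Ring Q]

/-- For a graded subring `S` of a `ℤ`-graded ring `Q`, the set
`S_{≥n} = S ∩ ⊕_{i≥n} Q_i` of elements of `S` all of whose homogeneous components
have degree at least `n`. -/
def degGE (𝒜 : ℤ → AddSubgroup Q) [GradedRing 𝒜] (S : Subring Q) (n : ℤ) : Set Q :=
  {x | x ∈ S ∧ ∀ i : ℤ, i < n → GradedRing.proj 𝒜 i x = 0}

/-- The maximal right torsion extension
`T(S) = {x ∈ Q : x · S_{≥n} ⊆ S for some n ≥ 0}`. -/
def maxRightTorsExt (𝒜 : ℤ → AddSubgroup Q) [GradedRing 𝒜] (S : Subring Q) : Set Q :=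
  {x | ∃ n : ℤ, 0 ≤ n ∧ ∀ s ∈ degGE 𝒜 S n, x * s ∈ S}

theorem proj_mul_eq_zero_of_lt (𝒜 : ℤ → AddSubgroup Q) [GradedRing 𝒜] {x y : Q} {a b : ℤ}
    (hx : ∀ i < a, GradedRing.proj 𝒜 i x = 0) (hy : ∀ j < b, GradedRing.proj 𝒜 j y = 0)
    {k : ℤ} (hk : k < a + b) : GradedRing.proj 𝒜 k (x * y) = 0 := by
  classical
  simp only [GradedRing.proj_apply] at hx hy ⊢
  rw [DirectSum.decompose_mul, DirectSum.coe_mul_apply]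
  refine Finset.sum_eq_zero fun ij hij => ?_
  have hsum : ij.1 + ij.2 = k := (Finset.mem_filter.mp hij).2
  rcases lt_or_ge ij.1 a with h | h
  · rw [hx _ h, zero_mul]
  · rw [hy _ (by omega), mul_zero]

theorem exists_proj_eq_zero_of_lt (𝒜 : ℤ → AddSubgroup Q) [GradedRing 𝒜] (x : Q) :
    ∃ a : ℤ, ∀ i < a, GradedRing.proj 𝒜 i x = 0 := by
  classical
  obtain ⟨a, ha⟩ := (DirectSum.decompose 𝒜 x).support.bddBelow
  refine ⟨a, fun i hi => ?_⟩
  by_contra h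
  refine absurd (ha (a := i) ?_) (not_le.mpr hi)
  simpa [GradedRing.proj_apply] using h

theorem degGE_anti (𝒜 : ℤ → AddSubgroup Q) [GradedRing 𝒜] (S : Subring Q) :
    Antitone (degGE 𝒜 S) :=
  fun _ _ hmn _ hs => ⟨hs.1, fun i hi => hs.2 i (hi.trans_le hmn)⟩

theorem proj_mem_degGE (𝒜 : ℤ → AddSubgroup Q) [GradedRing 𝒜] {S : Subring Q}
    (hcomp : ∀ x ∈ S, ∀ i : ℤ, GradedRing.proj 𝒜 i x ∈ S) {n : ℤ} {s : Q}
    (hs : s ∈ degGE 𝒜 S n) (j : ℤ) : GradedRing.proj 𝒜 j s ∈ degGE 𝒜 S n := by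
  refine ⟨hcomp s hs.1 j, fun i hi => ?_⟩
  by_cases hij : j = i
  · subst hij
    simp [hs.2 j hi]
  · exact DirectSum.decompose_of_mem_ne 𝒜 (SetLike.coe_mem (DirectSum.decompose 𝒜 s j)) hij

theorem subset_maxRightTorsExt (𝒜 : ℤ → AddSubgroup Q) [GradedRing 𝒜] (S : Subring Q) :
    (S : Set Q) ⊆ maxRightTorsExt 𝒜 S :=
  fun _ hx => ⟨0, le_rfl, fun _ hs => S.mul_mem hx hs.1⟩

theorem mul_mem_maxRightTorsExt (𝒜 : ℤ → AddSubgroup Q) [GradedRing 𝒜] {S : Subring Q}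
    {x y : Q} (hx : x ∈ maxRightTorsExt 𝒜 S) (hy : y ∈ maxRightTorsExt 𝒜 S) :
    x * y ∈ maxRightTorsExt 𝒜 S := by
  obtain ⟨m, -, hxm⟩ := hx
  obtain ⟨n, hn, hyn⟩ := hy
  obtain ⟨a, ha⟩ := exists_proj_eq_zero_of_lt 𝒜 y
  refine ⟨max n (m - a), hn.trans (le_max_left _ _), fun s hs => ?_⟩
  rw [mul_assoc]
  refine hxm _ ⟨hyn s (degGE_anti 𝒜 S (le_max_left _ _) hs), fun k hk => ?_⟩
  exact proj_mul_eq_zero_of_lt 𝒜 ha (degGE_anti 𝒜 S (le_max_right n (m - a)) hs).2 (by omega)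

theorem add_mem_maxRightTorsExt (𝒜 : ℤ → AddSubgroup Q) [GradedRing 𝒜] {S : Subring Q}
    {x y : Q} (hx : x ∈ maxRightTorsExt 𝒜 S) (hy : y ∈ maxRightTorsExt 𝒜 S) :
    x + y ∈ maxRightTorsExt 𝒜 S := by
  obtain ⟨m, hm, hxm⟩ := hx
  obtain ⟨n, -, hyn⟩ := hy
  refine ⟨max m n, hm.trans (le_max_left _ _), fun s hs => ?_⟩
  rw [add_mul]
  exact S.add_mem (hxm s (degGE_anti 𝒜 S (le_max_left _ _) hs))
    (hyn s (degGE_anti 𝒜 S (le_max_right _ _) hs))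

theorem neg_mem_maxRightTorsExt (𝒜 : ℤ → AddSubgroup Q) [GradedRing 𝒜] {S : Subring Q}
    {x : Q} (hx : x ∈ maxRightTorsExt 𝒜 S) : -x ∈ maxRightTorsExt 𝒜 S := by
  obtain ⟨n, hn, hxn⟩ := hx
  refine ⟨n, hn, fun s hs => ?_⟩
  rw [neg_mul]
  exact S.neg_mem (hxn s hs)

theorem proj_mem_maxRightTorsExt (𝒜 : ℤ → AddSubgroup Q) [GradedRing 𝒜] {S : Subring Q}
    (hcomp : ∀ x ∈ S, ∀ i : ℤ, GradedRing.proj 𝒜 i x ∈ S) {x : Q}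
    (hx : x ∈ maxRightTorsExt 𝒜 S) (i : ℤ) :
    GradedRing.proj 𝒜 i x ∈ maxRightTorsExt 𝒜 S := by
  classical
  obtain ⟨n, hn, hxn⟩ := hx
  refine ⟨n, hn, fun s hs => ?_⟩
  rw [← DirectSum.sum_support_decompose 𝒜 s, Finset.mul_sum]
  refine S.sum_mem fun j _ => ?_
  have h := hcomp _ (hxn _ (proj_mem_degGE 𝒜 hcomp hs j)) (i + j)
  rwa [GradedRing.proj_apply, GradedRing.proj_apply,
    DirectSum.coe_decompose_mul_add_of_right_mem 𝒜
      (SetLike.coe_mem (DirectSum.decompose 𝒜 s j))] at h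

/-- Let `S` be a graded subring, contained in nonnegative degrees, of a `ℤ`-graded ring
`Q`.  Then the maximal right torsion extension
`T(S) = {x ∈ Q : x·S_{≥n} ⊆ S for some n ≥ 0}` is a subring of `Q` containing `S`,
and `T(S)` is graded: each homogeneous component of an element of `T(S)` again lies
in `T(S)`. -/
theorem maxRightTorsExt_subring_graded (𝒜 : ℤ → AddSubgroup Q) [GradedRing 𝒜]
    (S : Subring Q)
    (hcomp : ∀ x ∈ S, ∀ i : ℤ, GradedRing.proj 𝒜 i x ∈ S)
    (hnonneg : ∀ x ∈ S, ∀ i : ℤ, i < 0 → GradedRing.proj 𝒜 i x = 0) :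
    (∃ T : Subring Q, (T : Set Q) = maxRightTorsExt 𝒜 S ∧ (S : Set Q) ⊆ T) ∧
      (∀ x ∈ maxRightTorsExt 𝒜 S, ∀ i : ℤ,
        GradedRing.proj 𝒜 i x ∈ maxRightTorsExt 𝒜 S) := by
  refine ⟨⟨
    { carrier := maxRightTorsExt 𝒜 S
      mul_mem' := mul_mem_maxRightTorsExt 𝒜
      one_mem' := subset_maxRightTorsExt 𝒜 S S.one_mem
      add_mem' := add_mem_maxRightTorsExt 𝒜
      zero_mem' := subset_maxRightTorsExt 𝒜 S S.zero_mem
      neg_mem' := neg_mem_maxRightTorsExt 𝒜 }, rfl, subset_maxRightTorsExt 𝒜 S⟩, ?_⟩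
  exact fun x hx i => proj_mem_maxRightTorsExt 𝒜 hcomp hx i
end
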